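/- arXiv:1704.00882 — 2 statements merged into one kernel-verified Lean document; each statement's English description precedes it below -/
import Mathlib

section
/- For every integer n ≥ 1, the sum of |crank(λ)| over all partitions λ of n is at most √(2n)·p(n). -/
open scoped BigOperators

namespace RankCrank

/-- The `i`-th largest part of a partition (1-indexed); `0` if `i` exceeds
the number of parts. -/
def part {n : ℕ} (l : n.Partition) (i : ℕ) : ℕ :=
  ((l.parts.sort (· ≤ ·)).reverse).getD (i - 1) 0

/-- The rank of a partition: largest part minus number of parts. -/
def rank {n : ℕ} (l : n.Partition) : ℤ :=
  (part l 1 : ℤ) - l.parts.card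

/-- The crank of a partition: the largest part if there are no parts equal to 1,
otherwise the number of parts larger than the number of 1's minus the number of 1's. -/
def crank {n : ℕ} (l : n.Partition) : ℤ :=
  if l.parts.count 1 = 0 then (part l 1 : ℤ)
  else ((l.parts.filter (fun x => l.parts.count 1 < x)).card : ℤ) - l.parts.count 1

/-- `N m n` is the number of partitions of `n` with rank `m`. -/
noncomputable def N (m : ℤ) (n : ℕ) : ℕ :=
  Nat.card {l : n.Partition // rank l = m}

/-- `M m n` is the number of partitions of `n` with crank `m` for `n ≠ 1`, with the
usual convention for `n = 1`. -/
noncomputable def M (m : ℤ) (n : ℕ) : ℤ :=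
  if n = 1 then (if m = 0 then -1 else if m = 1 ∨ m = -1 then 1 else 0)
  else (Nat.card {l : n.Partition // crank l = m} : ℤ)

/-- `Nle m n = N(≤ m, n) = ∑_{r ≤ m} N(r,n)`; since `N(r,n) = 0` for `r < -n`,
the sum may be taken over `-n ≤ r ≤ m`. -/
noncomputable def Nle (m : ℤ) (n : ℕ) : ℤ :=
  ∑ r ∈ Finset.Icc (-(n : ℤ)) m, (N r n : ℤ)

/-- `Mle m n = M(≤ m, n) = ∑_{r ≤ m} M(r,n)`; since `M(r,n) = 0` for `r < -n`,
the sum may be taken over `-n ≤ r ≤ m`. -/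
noncomputable def Mle (m : ℤ) (n : ℕ) : ℤ :=
  ∑ r ∈ Finset.Icc (-(n : ℤ)) m, M r n

/-- The number of partitions of `n`. -/
noncomputable def p (n : ℕ) : ℕ := Nat.card n.Partition

/-- `ospt n = ∑_{m ≥ 0} m M(m,n) - ∑_{m ≥ 0} m N(m,n)`; since ranks and cranks of
partitions of `n` are at most `n`, the sums may be taken over `0 ≤ m ≤ n`. -/
noncomputable def ospt (n : ℕ) : ℤ :=
  (∑ m ∈ Finset.Icc (0 : ℤ) (n : ℤ), m * M m n) -
    (∑ m ∈ Finset.Icc (0 : ℤ) (n : ℤ), m * (N m n : ℤ))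

/-- The rank-set of a partition `λ`:  `{j - λ_{j+1} : 0 ≤ j ≤ ℓ-1} ∪ {j : j ≥ ℓ}`
(note `part l (j+1) = 0` for `j ≥ ℓ`). -/
def rankSet {n : ℕ} (l : n.Partition) : Set ℤ :=
  {x | ∃ j : ℕ, x = (j : ℤ) - (part l (j + 1) : ℤ)}

/-- `q m n` is the number of partitions of `n` whose rank-set contains `m`. -/
noncomputable def q (m : ℤ) (n : ℕ) : ℕ :=
  Nat.card {l : n.Partition // m ∈ rankSet l}

/-- `prank m n` is the number of partitions of `n` with rank at least `m`. -/
noncomputable def prank (m : ℤ) (n : ℕ) : ℕ :=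
  Nat.card {l : n.Partition // m ≤ rank l}

/-- `jm m l` is the number of columns of the `m`-Durfee rectangle of `l`: the largest
`j ≥ 0` with `λ_{m+j} ≥ j`. -/
noncomputable def jm {n : ℕ} (m : ℕ) (l : n.Partition) : ℕ :=
  sSup {j : ℕ | j ≤ part l (m + j)}

/-- The total number of smallest parts in all partitions of `n`. -/
def spt (n : ℕ) : ℕ :=
  ∑ l : n.Partition, l.parts.count ((l.parts.sort (· ≤ ·)).headD 0)

/-- A bijection `τ` on partitions of `n` nearly preserves the rank–crank
distribution if `crank λ - rank (τ λ)` is `0` when `crank λ = 0`, is `0` or `1`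
when `crank λ > 0`, and is `0` or `-1` when `crank λ < 0`. -/
def NearlyPreserves {n : ℕ} (τ : n.Partition ≃ n.Partition) : Prop :=
  ∀ l : n.Partition,
    (crank l = 0 → crank l - rank (τ l) = 0) ∧
    (0 < crank l → crank l - rank (τ l) = 0 ∨ crank l - rank (τ l) = 1) ∧
    (crank l < 0 → crank l - rank (τ l) = 0 ∨ crank l - rank (τ l) = -1)

end RankCrank

namespace RankCrank

open Finset

/-- The number of elements of a multiset that exceed `j`. -/
def countGT (s : Multiset ℕ) (j : ℕ) : ℕ := s.countP (j < ·)

lemma countGT_add (s t : Multiset ℕ) (j : ℕ) :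
    countGT (s + t) j = countGT s j + countGT t j :=
  Multiset.countP_add _ s t

lemma countGT_cons (a : ℕ) (s : Multiset ℕ) (j : ℕ) :
    countGT (a ::ₘ s) j = countGT s j + if j < a then 1 else 0 :=
  Multiset.countP_cons _ a s

lemma countGT_eq_succ_add_count (s : Multiset ℕ) (j : ℕ) :
    countGT s j = countGT s (j + 1) + s.count (j + 1) := by
  induction s using Multiset.induction_on with
  | empty => simp [countGT]
  | cons a s ih =>
    rw [countGT_cons, countGT_cons, Multiset.count_cons, ih]
    split_ifs <;> omega

lemma countGT_antitone (s : Multiset ℕ) : Antitone (countGT s) :=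
  antitone_nat_of_succ_le fun j => by rw [countGT_eq_succ_add_count s j]; omega

lemma countGT_eq_zero {s : Multiset ℕ} {j : ℕ} (h : ∀ x ∈ s, x ≤ j) : countGT s j = 0 :=
  Multiset.countP_eq_zero.2 fun x hx => not_lt.2 (h x hx)

lemma countGT_zero {s : Multiset ℕ} (h : ∀ x ∈ s, 0 < x) : countGT s 0 = s.card :=
  Multiset.countP_eq_card.2 h

lemma countGT_pos_of_lt_sup {s : Multiset ℕ} {j : ℕ} (h : j < s.sup) : 0 < countGT s j := by
  rw [countGT, Multiset.countP_pos]
  by_contra! hs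
  exact absurd (Multiset.sup_le.2 hs) (not_le.2 h)

lemma sum_range_countGT {s : Multiset ℕ} {M : ℕ} (h : ∀ x ∈ s, x ≤ M) :
    ∑ j ∈ range M, countGT s j = s.sum := by
  induction s using Multiset.induction_on with
  | empty => simp [countGT]
  | cons a s ih =>
    have ha : a ≤ M := h a (Multiset.mem_cons_self a s)
    have hc : ({j ∈ range M | j < a} : Finset ℕ) = range a := by
      ext j; simp only [mem_filter, mem_range]; omega
    simp only [countGT_cons, sum_add_distrib, Multiset.sum_cons, ← card_filter, hc, card_range,
      ih fun x hx => h x (Multiset.mem_cons_of_mem hx)]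
    omega

lemma sum_range_succ_mul_count {s : Multiset ℕ} {M : ℕ} (h : ∀ x ∈ s, 0 < x ∧ x ≤ M) :
    ∑ j ∈ range M, (j + 1) * s.count (j + 1) = s.sum := by
  induction s using Multiset.induction_on with
  | empty => simp
  | cons a s ih =>
    obtain ⟨ha0, haM⟩ := h a (Multiset.mem_cons_self a s)
    obtain ⟨b, rfl⟩ : ∃ b, a = b + 1 := ⟨a - 1, by omega⟩
    simp only [Multiset.count_cons, mul_add, sum_add_distrib, Multiset.sum_cons,
      ih fun x hx => h x (Multiset.mem_cons_of_mem hx)]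
    simp [show b < M by omega, add_comm]

lemma part_one_eq_sup {n : ℕ} (l : n.Partition) : part l 1 = l.parts.sup := by
  have hp : (((l.parts.sort (· ≤ ·)).reverse : List ℕ) : Multiset ℕ) = l.parts := by
    rw [Multiset.coe_reverse, Multiset.sort_eq]
  have hs : (l.parts.sort (· ≤ ·)).reverse.Pairwise (fun a b => b ≤ a) :=
    List.pairwise_reverse.2 (Multiset.pairwise_sort l.parts (· ≤ ·))
  refine Eq.trans ?_ (congrArg Multiset.sup hp)
  rw [part]
  generalize (l.parts.sort (· ≤ ·)).reverse = r at hs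
  cases r with
  | nil => simp
  | cons a t =>
    rw [← Multiset.cons_coe, Multiset.sup_cons, sup_eq_left.2]
    · simp
    · exact Multiset.sup_le.2 fun b hb => List.rel_of_pairwise_cons hs (by simpa using hb)

/-- The conjugate partition. -/
def conj {n : ℕ} (l : n.Partition) : n.Partition where
  parts := (Multiset.range l.parts.sup).map (countGT l.parts)
  parts_pos := by
    intro i hi
    obtain ⟨j, hj, rfl⟩ := Multiset.mem_map.1 hi
    exact countGT_pos_of_lt_sup (Multiset.mem_range.1 hj)
  parts_sum := by
    exact (sum_range_countGT fun x hx => Multiset.le_sup hx).trans l.parts_sum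

lemma conj_injective (n : ℕ) : Function.Injective (conj (n := n)) := by
  intro l m h
  have hparts : (((List.range l.parts.sup).map (countGT l.parts) : List ℕ) : Multiset ℕ)
      = ((List.range m.parts.sup).map (countGT m.parts) : List ℕ) :=
    congrArg Nat.Partition.parts h
  have hsorted (s : Multiset ℕ) :
      ((List.range s.sup).map (countGT s)).Pairwise (fun a b => b ≤ a) :=
    List.pairwise_map.2 (List.pairwise_lt_range.imp fun hab => countGT_antitone s hab.le)
  have hlist := (Multiset.coe_eq_coe.1 hparts).eq_of_pairwise
    (fun a b _ _ h₁ h₂ => le_antisymm h₂ h₁) (hsorted _) (hsorted _)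
  have hsup : l.parts.sup = m.parts.sup := by simpa using congrArg List.length hlist
  have hcount (j : ℕ) : countGT l.parts j = countGT m.parts j := by
    rcases lt_or_ge j l.parts.sup with hj | hj
    · rw [← hsup] at hlist
      exact List.map_inj_left.1 hlist j (List.mem_range.2 hj)
    · rw [countGT_eq_zero fun x hx => (Multiset.le_sup hx).trans hj,
        countGT_eq_zero fun x hx => (Multiset.le_sup hx).trans (hsup ▸ hj)]
  ext i
  rcases i with _ | i
  · rw [Multiset.count_eq_zero.2 fun hz => (l.parts_pos hz).ne rfl,
      Multiset.count_eq_zero.2 fun hz => (m.parts_pos hz).ne rfl]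
  · have h₁ := countGT_eq_succ_add_count l.parts i
    have h₂ := countGT_eq_succ_add_count m.parts i
    rw [hcount, hcount] at h₁
    omega

lemma sum_sup_eq_sum_card (n : ℕ) (f : ℕ → ℤ) :
    ∑ l : n.Partition, f l.parts.sup = ∑ l : n.Partition, f l.parts.card :=
  Fintype.sum_bijective conj (Finite.injective_iff_bijective.1 (conj_injective n)) _ _
    fun l => by simp [conj]

/-- Summing over the partitions of `m` after adjoining the parts in `s` amounts to summing over
the partitions of `m + s.sum` whose parts contain `s`. -/
lemma sum_partition_add (m : ℕ) {n : ℕ} (s : Multiset ℕ) (hs : ∀ x ∈ s, 0 < x)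
    (hn : m + s.sum = n) (F : Multiset ℕ → ℤ) :
    ∑ μ : m.Partition, F (s + μ.parts)
      = ∑ l : n.Partition, if s ≤ l.parts then F l.parts else 0 := by
  rw [← sum_filter]
  refine sum_bij (fun μ _ => ⟨s + μ.parts, ?_, ?_⟩) ?_ ?_ ?_ ?_
  · intro i hi
    rcases Multiset.mem_add.1 hi with hi | hi
    · exact hs i hi
    · exact μ.parts_pos hi
  · rw [Multiset.sum_add, μ.parts_sum, ← hn, add_comm]
  · simp
  · intro μ _ ν _ h
    exact Nat.Partition.ext (add_left_cancel (congrArg Nat.Partition.parts h))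
  · intro l hl
    have hle : s ≤ l.parts := (mem_filter.1 hl).2
    have hsub : s + (l.parts - s) = l.parts := add_tsub_cancel_of_le hle
    refine ⟨⟨l.parts - s, fun {i} hi => l.parts_pos (Multiset.mem_of_le tsub_le_self hi), ?_⟩,
      mem_univ _, Nat.Partition.ext hsub⟩
    have h := congrArg Multiset.sum hsub
    rw [Multiset.sum_add, l.parts_sum] at h
    omega
  · simp

/-- The sum of `(N_j(μ) - j)²` over the partitions `μ` of `n - a`, where `N_j(μ)` is the number
of parts of `μ` exceeding `j`; it is `0` if `n < a`. -/
def shiftedMoment (n j a : ℕ) : ℤ :=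
  if a ≤ n then ∑ μ : (n - a).Partition, ((countGT μ.parts j : ℤ) - j) ^ 2 else 0

lemma count_one_le {n : ℕ} (l : n.Partition) : l.parts.count 1 ≤ n := by
  obtain ⟨t, ht⟩ := Multiset.le_iff_exists_add.1
    (Multiset.le_count_iff_replicate_le.1 (le_refl (l.parts.count 1)))
  have h := congrArg Multiset.sum ht
  rw [Multiset.sum_add, l.parts_sum] at h
  simp at h
  omega

lemma sum_ite_le_count_one (n a : ℕ) {j : ℕ} (hj : 1 ≤ j) :
    (∑ l : n.Partition, if a ≤ l.parts.count 1 then ((countGT l.parts j : ℤ) - j) ^ 2 else 0)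
      = shiftedMoment n j a := by
  simp only [Multiset.le_count_iff_replicate_le]
  unfold shiftedMoment
  split_ifs with ha
  · rw [← sum_partition_add (n - a) (Multiset.replicate a 1)
      (fun x hx => by simp [Multiset.eq_of_mem_replicate hx])
      (by simp; omega) (fun s => ((countGT s j : ℤ) - j) ^ 2)]
    refine sum_congr rfl fun μ _ => ?_
    rw [countGT_add, countGT_eq_zero (s := Multiset.replicate a 1)
      fun x hx => (Multiset.eq_of_mem_replicate hx).trans_le hj, zero_add]
  · refine sum_eq_zero fun l _ => if_neg fun h => ha ?_
    exact (Multiset.le_count_iff_replicate_le.2 h).trans (count_one_le l)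

lemma sum_sq_sup_of_no_ones {n : ℕ} (hn : 2 ≤ n) :
    (∑ l : n.Partition, if l.parts.count 1 = 0 then (l.parts.sup : ℤ) ^ 2 else 0)
      = shiftedMoment n 0 0 - shiftedMoment n 0 1 := by
  have hcard (k : ℕ) (l : k.Partition) : countGT l.parts 0 = l.parts.card :=
    countGT_zero fun _ hx => l.parts_pos hx
  have h₁ : shiftedMoment n 0 1
      = ∑ l : n.Partition, if ({1} : Multiset ℕ) ≤ l.parts then (l.parts.sup : ℤ) ^ 2 else 0 := by
    rw [← sum_partition_add (n - 1) {1} (by simp) (by simp; omega) (fun s => (s.sup : ℤ) ^ 2),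
      shiftedMoment, if_pos (by omega)]
    simp only [hcard, Nat.cast_zero, sub_zero]
    rw [← sum_sup_eq_sum_card (n - 1) (fun k => (k : ℤ) ^ 2)]
    refine sum_congr rfl fun μ _ => ?_
    have hne : μ.parts ≠ 0 := fun h => by
      have := μ.parts_sum
      simp [h] at this
      omega
    obtain ⟨x, hx⟩ := Multiset.exists_mem_of_ne_zero hne
    have hsup : 1 ≤ μ.parts.sup := le_trans (μ.parts_pos hx) (Multiset.le_sup hx)
    rw [Multiset.sup_add, Multiset.sup_singleton, sup_eq_right.2 hsup]
  have h₀ : shiftedMoment n 0 0 = ∑ l : n.Partition, (l.parts.sup : ℤ) ^ 2 := by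
    rw [sum_sup_eq_sum_card n (fun k => (k : ℤ) ^ 2)]
    simp [shiftedMoment, hcard]
  rw [h₀, h₁, ← sum_sub_distrib]
  refine sum_congr rfl fun l _ => ?_
  simp only [Multiset.singleton_le, ← Multiset.count_pos]
  split_ifs <;> omega

lemma crank_sq {n : ℕ} (l : n.Partition) :
    crank l ^ 2 = (if l.parts.count 1 = 0 then (l.parts.sup : ℤ) ^ 2 else 0)
      + ∑ j ∈ range n, ((if j + 1 ≤ l.parts.count 1 then
            ((countGT l.parts (j + 1) : ℤ) - (j + 1 : ℕ)) ^ 2 else 0)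
          - if j + 1 + 1 ≤ l.parts.count 1 then
            ((countGT l.parts (j + 1) : ℤ) - (j + 1 : ℕ)) ^ 2 else 0) := by
  have hle : l.parts.count 1 ≤ n := count_one_le l
  unfold crank
  rw [part_one_eq_sup]
  split_ifs with h
  · simp [h]
  · rw [← Multiset.countP_eq_card_filter]
    obtain ⟨k, hk⟩ : ∃ k, l.parts.count 1 = k + 1 := ⟨l.parts.count 1 - 1, by omega⟩
    rw [hk] at hle ⊢
    rw [sum_eq_single_of_mem k (mem_range.2 (by omega))]
    · simp [countGT]
    · intro j _ hj
      split_ifs <;> omega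

lemma shiftedMoment_succ_sub {n j : ℕ} (hj : j < n) :
    shiftedMoment n (j + 1) (j + 1) - shiftedMoment n j (j + 1)
      = ∑ l : n.Partition, ((countGT l.parts (j + 1) : ℤ) ^ 2 - (countGT l.parts j : ℤ) ^ 2
          + 2 * (((j + 1) * l.parts.count (j + 1) : ℕ) : ℤ)) := by
  have h := sum_partition_add (n - (j + 1)) (n := n) {j + 1} (by simp) (by simp; omega)
    (fun s => (countGT s (j + 1) : ℤ) ^ 2 - (countGT s j : ℤ) ^ 2
      + 2 * (((j + 1) * s.count (j + 1) : ℕ) : ℤ))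
  rw [shiftedMoment, shiftedMoment, if_pos (by omega), if_pos (by omega), ← sum_sub_distrib]
  refine Eq.trans (sum_congr rfl fun μ _ => ?_) (h.trans (sum_congr rfl fun l _ => ?_))
  · rw [Multiset.singleton_add, countGT_cons, countGT_cons, Multiset.count_cons_self,
      countGT_eq_succ_add_count μ.parts j]
    simp
    ring
  · split_ifs with hl
    · rfl
    · rw [Multiset.singleton_le, ← Multiset.count_pos, not_lt, Nat.le_zero] at hl
      simp [countGT_eq_succ_add_count l.parts j, hl]

/-- Dyson's identity for the second moment of the crank. -/
theorem sum_crank_sq {n : ℕ} (hn : 2 ≤ n) :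
    ∑ l : n.Partition, crank l ^ 2 = 2 * n * p n := by
  have htel : ∑ l : n.Partition, crank l ^ 2 = shiftedMoment n 0 0
      + ∑ j ∈ range n, (shiftedMoment n (j + 1) (j + 1) - shiftedMoment n j (j + 1)) := by
    have hlast : shiftedMoment n n (n + 1) = 0 := if_neg (by omega)
    have hrange := (sum_range_succ' (fun j => shiftedMoment n j (j + 1)) n).symm.trans
      (sum_range_succ (fun j => shiftedMoment n j (j + 1)) n)
    simp only [crank_sq, sum_add_distrib]
    rw [sum_sq_sup_of_no_ones hn, sum_comm]
    simp only [sum_sub_distrib]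
    simp only [sum_ite_le_count_one n _ (Nat.succ_pos _)]
    simp only [zero_add] at hrange
    linarith
  rw [htel, sum_congr rfl fun j hj => shiftedMoment_succ_sub (mem_range.1 hj), sum_comm,
    shiftedMoment, if_pos (Nat.zero_le n), Nat.sub_zero, ← sum_add_distrib]
  rw [sum_congr rfl (g := fun _ => (2 * n : ℤ))]
  · simp [p, mul_comm]
  · intro l _
    have hle : ∀ x ∈ l.parts, x ≤ n := fun x hx => l.le_of_mem_parts hx
    rw [sum_add_distrib, sum_range_sub (fun j => (countGT l.parts j : ℤ) ^ 2), ← mul_sum,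
      ← Nat.cast_sum, sum_range_succ_mul_count fun x hx => ⟨l.parts_pos hx, hle x hx⟩,
      l.parts_sum, countGT_eq_zero hle]
    simp

lemma sum_crank_sq_le {n : ℕ} (hn : 1 ≤ n) :
    ∑ l : n.Partition, crank l ^ 2 ≤ 2 * n * p n := by
  rcases hn.eq_or_lt with rfl | hn
  · have hf : ({1} : Multiset ℕ).filter (1 < ·) = 0 := by decide
    simp [crank, p, hf]
  · exact (sum_crank_sq hn).le

end RankCrank

open RankCrank in
/-- For every `n ≥ 1`, the sum of `|crank λ|` over all partitions `λ` of `n` is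
at most `√(2n)·p(n)`. -/
theorem sum_abs_crank_le (n : ℕ) (hn : 1 ≤ n) :
    ((∑ l : n.Partition, |crank l| : ℤ) : ℝ)
      ≤ Real.sqrt (2 * n) * (p n : ℝ) := by
  have hcs := sq_sum_le_card_mul_sum_sq (s := (Finset.univ : Finset n.Partition))
    (f := fun l => |crank l|)
  simp only [sq_abs, Finset.card_univ, ← Nat.card_eq_fintype_card] at hcs
  have hle : (∑ l : n.Partition, |crank l|) ^ 2 ≤ 2 * n * (p n : ℤ) ^ 2 :=
    calc _ ≤ (p n : ℤ) * ∑ l : n.Partition, crank l ^ 2 := hcs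
      _ ≤ (p n : ℤ) * (2 * n * p n) := by gcongr; exact sum_crank_sq_le hn
      _ = 2 * n * (p n : ℤ) ^ 2 := by ring
  rw [← Real.sqrt_sq (Nat.cast_nonneg (p n)), ← Real.sqrt_mul (by positivity)]
  exact Real.le_sqrt_of_sq_le (by exact_mod_cast hle)
end

section
/- For every integer n ≥ 1, spt(n) ≤ √(2n)·p(n). -/
open scoped BigOperators

namespace RankCrank

theorem card_mul_card_add_le_two_mul_sum (a : ℕ) (F : Finset ℕ) (h : ∀ x ∈ F, a ≤ x) :
    F.card * F.card + 2 * a * F.card ≤ 2 * ∑ x ∈ F, x + F.card := by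
  induction F using Finset.induction_on_max with
  | empty => simp
  | insert M F hM ih =>
    have hnot : M ∉ F := fun hm => lt_irrefl _ (hM M hm)
    have hsub : F ⊆ Finset.Ico a M := fun x hx =>
      Finset.mem_Ico.2 ⟨h x (Finset.mem_insert_of_mem hx), hM x hx⟩
    have hcard := Finset.card_le_card hsub
    rw [Nat.card_Ico] at hcard
    have haM := h M (Finset.mem_insert_self _ _)
    have := ih fun x hx => h x (Finset.mem_insert_of_mem hx)
    rw [Finset.card_insert_of_notMem hnot, Finset.sum_insert hnot]
    have : F.card + a ≤ M := by omega
    nlinarith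

theorem sum_toFinset_add_count_one_le (s : Multiset ℕ) :
    ∑ x ∈ s.toFinset, x + s.count 1 ≤ s.sum + 1 := by
  rw [Finset.sum_multiset_count s]
  simp only [smul_eq_mul]
  have key : ∀ x ∈ s.toFinset, x ≤ s.count x * x := fun x hx =>
    Nat.le_mul_of_pos_left _ (Multiset.count_pos.2 (Multiset.mem_toFinset.1 hx))
  by_cases h1 : 1 ∈ s.toFinset
  · rw [← Finset.add_sum_erase _ _ h1, ← Finset.add_sum_erase _ (fun x => s.count x * x) h1]
    have := Finset.sum_le_sum fun x (hx : x ∈ s.toFinset.erase 1) =>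
      key x (Finset.mem_of_mem_erase hx)
    omega
  · have := Finset.sum_le_sum key
    have : s.count 1 = 0 := by simpa using h1
    omega

theorem sum_toFinset_le (s : Multiset ℕ) : ∑ x ∈ s.toFinset, x ≤ s.sum := by
  rw [Finset.sum_multiset_count s]
  exact Finset.sum_le_sum fun x hx =>
    Nat.le_mul_of_pos_left _ (Multiset.count_pos.2 (Multiset.mem_toFinset.1 hx))

/-- The smallest part different from `1` exists and divides the number of `1`s. -/
def LeastNonOneDvd (s : Multiset ℕ) : Prop :=
  ∃ d ∈ s, 2 ≤ d ∧ (∀ x ∈ s, x ≠ 1 → d ≤ x) ∧ d ∣ s.count 1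

section

variable {n : ℕ}

theorem headD_sort_mem_and_le (s : Multiset ℕ) (hs : s ≠ 0) :
    (s.sort (· ≤ ·)).headD 0 ∈ s ∧ ∀ x ∈ s, (s.sort (· ≤ ·)).headD 0 ≤ x := by
  have hp := Multiset.pairwise_sort s (· ≤ ·)
  have hm : ∀ x, x ∈ s.sort (· ≤ ·) ↔ x ∈ s := fun x => Multiset.mem_sort _
  rcases hl : s.sort (· ≤ ·) with _ | ⟨a, t⟩
  · exact absurd (by rw [← Multiset.sort_eq s (· ≤ ·), hl]; rfl) hs
  · rw [hl] at hp hm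
    simp only [List.headD_cons]
    refine ⟨(hm a).1 (by simp), fun x hx => ?_⟩
    rcases List.mem_cons.1 ((hm x).2 hx) with rfl | hx
    · exact le_rfl
    · exact (List.pairwise_cons.1 hp).1 x hx

theorem parts_ne_zero (hn : 1 ≤ n) (l : n.Partition) : l.parts ≠ 0 := by
  intro h
  have := l.parts_sum
  simp [h] at this
  omega

/-- The smallest part of a partition. -/
def least (l : n.Partition) : ℕ := (l.parts.sort (· ≤ ·)).headD 0

theorem least_mem (hn : 1 ≤ n) (l : n.Partition) : least l ∈ l.parts :=
  (headD_sort_mem_and_le _ (parts_ne_zero hn l)).1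

theorem least_le {l : n.Partition} {x : ℕ} (hx : x ∈ l.parts) : least l ≤ x :=
  (headD_sort_mem_and_le _ (by rintro h; simp [h] at hx)).2 x hx

/-- The number of distinct part sizes. -/
def numDistinct (l : n.Partition) : ℕ := l.parts.toFinset.card

theorem numDistinct_sq_add_le (l : n.Partition) :
    numDistinct l * numDistinct l + numDistinct l + 2 * l.parts.count 1 ≤ 2 * n + 2 := by
  have h1 := card_mul_card_add_le_two_mul_sum 1 l.parts.toFinset
    fun x hx => l.parts_pos (Multiset.mem_toFinset.1 hx)
  have h2 := sum_toFinset_add_count_one_le l.parts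
  rw [l.parts_sum] at h2
  unfold numDistinct
  omega

theorem numDistinct_sq_le (l : n.Partition) :
    numDistinct l * numDistinct l + numDistinct l ≤ 2 * n := by
  have h1 := card_mul_card_add_le_two_mul_sum 1 l.parts.toFinset
    fun x hx => l.parts_pos (Multiset.mem_toFinset.1 hx)
  have h2 := sum_toFinset_le l.parts
  rw [l.parts_sum] at h2
  unfold numDistinct
  omega

theorem sum_count_one_le :
    ∑ l : n.Partition, l.parts.count 1 ≤ ∑ l : n.Partition, numDistinct l := by
  have hk : ∀ (l : n.Partition) (k : Fin (l.parts.count 1)),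
      Multiset.replicate (k + 1) 1 ≤ l.parts := fun l k =>
    Multiset.le_count_iff_replicate_le.1 k.2
  let F : (Σ l : n.Partition, Fin (l.parts.count 1)) →
      (Σ l : n.Partition, {v // v ∈ l.parts.toFinset}) := fun x =>
    ⟨⟨(x.1.parts - Multiset.replicate (x.2 + 1) 1) + {(x.2 : ℕ) + 1}, by
        intro i hi
        rcases Multiset.mem_add.1 hi with hi | hi
        · exact x.1.parts_pos (Multiset.mem_of_le (Multiset.sub_le_self _ _) hi)
        · rw [Multiset.mem_singleton.1 hi]; omega, by
        have := congrArg Multiset.sum (tsub_add_cancel_of_le (hk x.1 x.2))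
        simp only [Multiset.sum_add, Multiset.sum_replicate, x.1.parts_sum] at this
        simpa using this⟩, ⟨x.2 + 1, by simp⟩⟩
  have hF : Function.Injective F := by
    rintro ⟨l, k⟩ ⟨l', k'⟩ h
    have h1 := congrArg (fun y => y.1.parts) h
    have h2 : (k : ℕ) + 1 = k' + 1 := congrArg (fun y => (y.2 : ℕ)) h
    simp only [F] at h1
    rw [h2] at h1
    have h3 := add_right_cancel h1
    have h4 : l.parts = l'.parts := by
      rw [← tsub_add_cancel_of_le (hk l k), ← tsub_add_cancel_of_le (hk l' k'), h2, h3]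
    obtain rfl : l = l' := Nat.Partition.ext h4
    obtain rfl : k = k' := Fin.ext (by omega)
    rfl
  have := Fintype.card_le_of_injective F hF
  simp only [Fintype.card_sigma, Fintype.card_fin, Fintype.card_coe] at this
  exact this

open Classical in
theorem sum_count_least_le (hn : 1 ≤ n) :
    ∑ l : n.Partition, (if least l = 1 then 0 else l.parts.count (least l)) ≤
      ∑ l : n.Partition, (if LeastNonOneDvd l.parts then 1 else 0) := by
  let c : n.Partition → ℕ := fun l => if least l = 1 then 0 else l.parts.count (least l)
  have hc : ∀ (l : n.Partition) (k : Fin (c l)), 2 ≤ least l ∧ k < l.parts.count (least l) := by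
    intro l k
    have hk := k.2
    have := l.parts_pos (least_mem hn l)
    simp only [c] at hk
    split_ifs at hk
    · omega
    · exact ⟨by omega, hk⟩
  have hrep : ∀ (l : n.Partition) (k : Fin (c l)),
      Multiset.replicate k (least l) ≤ l.parts := fun l k =>
    Multiset.le_count_iff_replicate_le.1 (hc l k).2.le
  have hone : ∀ (l : n.Partition) (k : Fin (c l)), 1 ∉ l.parts := fun l k h => by
    have := least_le h
    have := hc l k
    omega
  let P : (x : Σ l : n.Partition, Fin (c l)) → Multiset ℕ := fun x =>
    (x.1.parts - Multiset.replicate x.2 (least x.1)) +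
      Multiset.replicate (x.2 * least x.1) 1
  have hcount : ∀ x, (P x).count 1 = x.2 * least x.1 := by
    intro x
    have : x.1.parts.count 1 = 0 := Multiset.count_eq_zero.2 (hone x.1 x.2)
    simp [P, this]
  have hmem : ∀ x, least x.1 ∈ P x := by
    intro x
    refine Multiset.mem_add.2 (Or.inl (Multiset.count_pos.1 ?_))
    have := (hc x.1 x.2).2
    simp
    omega
  have hle : ∀ x, ∀ y ∈ P x, y ≠ 1 → least x.1 ≤ y := by
    intro x y hy hy1
    rcases Multiset.mem_add.1 hy with hy | hy
    · exact least_le (Multiset.mem_of_le (Multiset.sub_le_self _ _) hy)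
    · exact absurd (Multiset.eq_of_mem_replicate hy) hy1
  let F : (Σ l : n.Partition, Fin (c l)) → {l : n.Partition // LeastNonOneDvd l.parts} :=
    fun x => ⟨⟨P x, by
        intro i hi
        rcases Multiset.mem_add.1 hi with hi | hi
        · exact x.1.parts_pos (Multiset.mem_of_le (Multiset.sub_le_self _ _) hi)
        · rw [Multiset.eq_of_mem_replicate hi]; omega, by
        have := congrArg Multiset.sum (tsub_add_cancel_of_le (hrep x.1 x.2))
        simpa [P, x.1.parts_sum] using this⟩,
      least x.1, hmem x, (hc x.1 x.2).1, hle x, by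
        rw [hcount x]; exact dvd_mul_left _ _⟩
  have hF : Function.Injective F := by
    rintro ⟨l, k⟩ ⟨l', k'⟩ h
    have hP : P ⟨l, k⟩ = P ⟨l', k'⟩ := congrArg (fun y => y.1.parts) h
    have h2 := (hc l k).1
    have h2' := (hc l' k').1
    have hd : least l = least l' := le_antisymm
      (hle ⟨l, k⟩ _ (hP ▸ hmem ⟨l', k'⟩) (by omega))
      (hle ⟨l', k'⟩ _ (hP ▸ hmem ⟨l, k⟩) (by omega))
    have hkk : (k : ℕ) = k' := by
      have := hcount ⟨l, k⟩
      rw [hP, hcount ⟨l', k'⟩] at this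
      simp only [hd] at this
      exact (Nat.eq_of_mul_eq_mul_right (by omega) this).symm
    simp only [P] at hP
    rw [hd, hkk] at hP
    have h3 := add_right_cancel hP
    have h4 : l.parts = l'.parts := by
      rw [← tsub_add_cancel_of_le (hrep l k), ← tsub_add_cancel_of_le (hrep l' k'), hd, hkk, h3]
    obtain rfl : l = l' := Nat.Partition.ext h4
    obtain rfl : k = k' := Fin.ext hkk
    rfl
  have := Fintype.card_le_of_injective F hF
  rw [Fintype.card_sigma, Fintype.card_subtype, Finset.card_filter] at this
  simpa [c] using this

open Classical in
/-- A weight whose total over the partitions of `n` bounds `spt n`. -/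
noncomputable def weight (l : n.Partition) : ℕ :=
  numDistinct l + if LeastNonOneDvd l.parts then 1 else 0

theorem spt_le_sum_weight (hn : 1 ≤ n) : spt n ≤ ∑ l : n.Partition, weight l := by
  classical
  unfold weight
  rw [Finset.sum_add_distrib]
  refine le_trans ?_ (add_le_add sum_count_one_le (sum_count_least_le hn))
  rw [← Finset.sum_add_distrib]
  refine Finset.sum_le_sum fun l _ => ?_
  change l.parts.count (least l) ≤ _
  split_ifs with h <;> simp [h]

/-- The partitions whose weight may exceed `√(2n)`. -/
def Heavy (l : n.Partition) : Prop :=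
  LeastNonOneDvd l.parts ∧ 2 * n < (numDistinct l + 1) ^ 2

theorem weight_le_sqrt {l : n.Partition} (h : ¬ Heavy l) :
    (weight l : ℝ) ≤ Real.sqrt (2 * n) := by
  apply Real.le_sqrt_of_sq_le
  have hl := numDistinct_sq_le l
  have : weight l ^ 2 ≤ 2 * n := by
    unfold weight
    split_ifs with hd
    · exact not_lt.1 fun hlt => h ⟨hd, hlt⟩
    · nlinarith
  exact_mod_cast this

theorem Heavy.two_le_count_one {l : n.Partition} (h : Heavy l) : 2 ≤ l.parts.count 1 := by
  obtain ⟨⟨d, hd, hd2, hmin, hdvd⟩, hlt⟩ := h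
  rcases Nat.eq_zero_or_pos (l.parts.count 1) with h0 | h0
  · exfalso
    have h1 : 1 ∉ l.parts := Multiset.count_eq_zero.1 h0
    have h2 := card_mul_card_add_le_two_mul_sum 2 l.parts.toFinset fun x hx => by
      have hx := Multiset.mem_toFinset.1 hx
      exact hd2.trans (hmin x hx fun h => h1 (h ▸ hx))
    have h3 := sum_toFinset_le l.parts
    rw [l.parts_sum] at h3
    have h4 : 0 < l.parts.toFinset.card :=
      Finset.card_pos.2 ⟨d, Multiset.mem_toFinset.2 hd⟩
    unfold numDistinct at hlt
    nlinarith
  · exact hd2.trans (Nat.le_of_dvd h0 hdvd)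

theorem Heavy.exists_max {l : n.Partition} (h : Heavy l) :
    ∃ L, 2 ≤ L ∧ L ∈ l.parts ∧ ∀ x ∈ l.parts, x ≤ L := by
  obtain ⟨⟨d, hd, hd2, -⟩, -⟩ := h
  have hne : l.parts.toFinset.Nonempty := ⟨d, Multiset.mem_toFinset.2 hd⟩
  have hle : ∀ x ∈ l.parts, x ≤ l.parts.toFinset.max' hne := fun x hx =>
    Finset.le_max' _ _ (Multiset.mem_toFinset.2 hx)
  exact ⟨_, hd2.trans (hle d hd), Multiset.mem_toFinset.1 (Finset.max'_mem _ hne), hle⟩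

theorem Heavy.exists_light {l : n.Partition} (h : Heavy l) :
    ∃ (m : n.Partition) (L : ℕ), ({1, L} : Multiset ℕ) ≤ l.parts ∧
      m.parts = l.parts - {1, L} + {L + 1} ∧ (∀ x ∈ l.parts, x ≤ L) ∧
      ¬ LeastNonOneDvd m.parts := by
  obtain ⟨L, hL2, hL, hmax⟩ := h.exists_max
  have hc := h.two_le_count_one
  have hsub : ({1, L} : Multiset ℕ) ≤ l.parts := by
    rw [Multiset.le_iff_count]
    intro a
    have h1 := Multiset.count_pos.2 hL
    simp only [Multiset.insert_eq_cons, Multiset.count_cons, Multiset.count_singleton]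
    split_ifs <;> subst_vars <;> omega
  have hsum := congrArg Multiset.sum (tsub_add_cancel_of_le hsub)
  refine ⟨⟨l.parts - {1, L} + {L + 1}, ?_, ?_⟩, L, hsub, rfl, hmax, ?_⟩
  · intro i hi
    rcases Multiset.mem_add.1 hi with hi | hi
    · exact l.parts_pos (Multiset.mem_of_le (Multiset.sub_le_self _ _) hi)
    · rw [Multiset.mem_singleton.1 hi]; omega
  · simp [l.parts_sum] at hsum
    simp
    omega
  · rintro ⟨e, he, he2, hemin, hedvd⟩
    have hone : (l.parts - {1, L} + {L + 1}).count 1 = l.parts.count 1 - 1 := by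
      have h1 : L ≠ 1 := by omega
      have h2 : L ≠ 0 := by omega
      simp [Multiset.insert_eq_cons, h1.symm, h2]
    simp only [hone] at hedvd
    obtain ⟨⟨d, hd, hd2, hmin, hdvd⟩, hlt⟩ := h
    have hmem : ∀ x, x ∈ l.parts - {1, L} + {L + 1} → x = L + 1 ∨ x ∈ l.parts := by
      intro x hx
      rcases Multiset.mem_add.1 hx with hx | hx
      · exact Or.inr (Multiset.mem_of_le (Multiset.sub_le_self _ _) hx)
      · exact Or.inl (Multiset.mem_singleton.1 hx)
    have hdL := hmax d hd
    have hde : d ≤ e := by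
      rcases hmem e he with rfl | he'
      · omega
      · exact hmin e he' (by omega)
    by_cases hd' : d ∈ l.parts - {1, L} + {L + 1}
    · obtain rfl : d = e := le_antisymm hde (hemin d hd' (by omega))
      have := (Nat.dvd_sub_iff_right (by omega) hdvd).1 hedvd
      have := Nat.le_of_dvd one_pos this
      omega
    · have hdL' : d = L := by
        by_contra hne
        apply hd'
        refine Multiset.mem_add.2 (Or.inl (Multiset.count_pos.1 ?_))
        have h1 := Multiset.count_pos.2 hd
        have h2 : d ≠ 1 := by omega
        simpa [Multiset.insert_eq_cons, Multiset.count_cons, Multiset.count_singleton, hne, h2]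
          using h1
      have heL : e = L + 1 := by
        rcases hmem e he with h1 | h1
        · exact h1
        · have := hmax e h1
          obtain rfl : e = d := by omega
          exact absurd he hd'
      have hcard : numDistinct l ≤ 2 := by
        refine (Finset.card_le_card (t := {1, d}) fun x hx => ?_).trans Finset.card_le_two
        have hx := Multiset.mem_toFinset.1 hx
        by_cases hx1 : x = 1
        · simp [hx1]
        · have := hmin x hx hx1
          have := hmax x hx
          simp only [Finset.mem_insert, Finset.mem_singleton]
          omega
      have h1 := Nat.le_of_dvd (by omega) hedvd
      have h2 : d + 2 ≤ l.parts.count 1 := by omega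
      have h3 := sum_toFinset_add_count_one_le l.parts
      have h4 : d ≤ ∑ x ∈ l.parts.toFinset, x :=
        Finset.single_le_sum (f := fun x : ℕ => x) (fun _ _ => Nat.zero_le _)
          (Multiset.mem_toFinset.2 hd)
      rw [l.parts_sum] at h3
      have h5 : (numDistinct l + 1) ^ 2 ≤ 3 ^ 2 := Nat.pow_le_pow_left (by omega) 2
      omega

theorem Heavy.weight_add_weight_le {l m : n.Partition} (h : Heavy l)
    (hm : ¬ LeastNonOneDvd m.parts) :
    (weight l : ℝ) + weight m ≤ 2 * Real.sqrt (2 * n) := by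
  have h1 := numDistinct_sq_add_le l
  have h2 := h.two_le_count_one
  have h3 := numDistinct_sq_le m
  have hmt : numDistinct m ≤ numDistinct l := by
    by_contra! hlt
    have := h.2
    nlinarith
  have key : (numDistinct l : ℝ) + 1 / 2 ≤ Real.sqrt (2 * n) := by
    apply Real.le_sqrt_of_sq_le
    have : (numDistinct l : ℝ) * numDistinct l + numDistinct l + 2 ≤ 2 * n := by
      exact_mod_cast (by omega :
        numDistinct l * numDistinct l + numDistinct l + 2 ≤ 2 * n)
    nlinarith
  have hmt' : (numDistinct m : ℝ) ≤ numDistinct l := by exact_mod_cast hmt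
  simp only [weight, if_pos h.1, if_neg hm]
  push_cast
  linarith

theorem sum_weight_le :
    (∑ l : n.Partition, (weight l : ℝ)) ≤ Real.sqrt (2 * n) * p n := by
  classical
  set T := Real.sqrt (2 * n)
  choose! f L hsub hf hmax hlight using fun l : n.Partition => Heavy.exists_light (l := l)
  let A : Finset n.Partition := Finset.univ.filter Heavy
  have hA : ∀ l, l ∈ A ↔ Heavy l := fun l => by simp [A]
  have hinj : Set.InjOn f A := by
    intro l hl l' hl' h
    have hl := (hA l).1 hl
    have hl' := (hA l').1 hl'
    have aux : ∀ k k' : n.Partition, Heavy k → Heavy k' → f k = f k' → L k ≤ L k' := by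
      intro k k' hk hk' h
      have hmem : L k + 1 ∈ (f k').parts := by rw [← h, hf k hk]; simp
      rw [hf k' hk'] at hmem
      rcases Multiset.mem_add.1 hmem with hx | hx
      · have := hmax k' hk' _ (Multiset.mem_of_le (Multiset.sub_le_self _ _) hx)
        omega
      · have := Multiset.mem_singleton.1 hx
        omega
    have hLL : L l = L l' := le_antisymm (aux l l' hl hl' h) (aux l' l hl' hl h.symm)
    have h1 := congrArg Nat.Partition.parts h
    rw [hf l hl, hf l' hl', hLL] at h1
    have h2 := add_right_cancel h1
    apply Nat.Partition.ext
    rw [← tsub_add_cancel_of_le (hsub l hl), ← tsub_add_cancel_of_le (hsub l' hl'), hLL, h2]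
  have himage : A.image f ⊆ Aᶜ := by
    intro m hm
    obtain ⟨l, hl, rfl⟩ := Finset.mem_image.1 hm
    exact Finset.mem_compl.2 fun h => hlight l ((hA l).1 hl) ((hA _).1 h).1
  have hnonneg : 0 ≤ ∑ l : n.Partition, (T - weight l) := by
    rw [← Finset.sum_add_sum_compl A]
    have h1 : ∑ l ∈ A.image f, (T - weight l) ≤ ∑ l ∈ Aᶜ, (T - weight l) :=
      Finset.sum_le_sum_of_subset_of_nonneg himage fun l hl _ =>
        sub_nonneg.2 (weight_le_sqrt fun h => Finset.mem_compl.1 hl ((hA l).2 h))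
    rw [Finset.sum_image hinj] at h1
    have h2 : 0 ≤ ∑ l ∈ A, ((T - weight l) + (T - weight (f l))) :=
      Finset.sum_nonneg fun l hl => by
        have hl := (hA l).1 hl
        have := hl.weight_add_weight_le (hlight l hl)
        linarith
    rw [Finset.sum_add_distrib] at h2
    linarith
  rw [Finset.sum_sub_distrib, Finset.sum_const, Finset.card_univ, nsmul_eq_mul] at hnonneg
  rw [p, Nat.card_eq_fintype_card]
  linarith

end

end RankCrank

open RankCrank in
/-- For every `n ≥ 1`, `spt n ≤ √(2n)·p(n)`. -/
theorem spt_le_sqrt (n : ℕ) (hn : 1 ≤ n) :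
    (spt n : ℝ) ≤ Real.sqrt (2 * n) * (p n : ℝ) := by
  refine le_trans ?_ sum_weight_le
  exact_mod_cast spt_le_sum_weight hn
end
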